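/- Let β > 1/2. There exists a constant C = C(β, N) such that for every integer n ≥ 1, n · Σ_{k=0}^{n−1} ( (1 − λ_k/λ_n)^β − (1 − λ_{k+1}/λ_n)^β )² ≤ C, where the term with k+1 = n is (1 − λ_k/λ_n)^{2β} (since (1 − λ_n/λ_n)^β = 0). -/

import Mathlib

open MeasureTheory Metric Finset
open scoped ENNReal NNReal

noncomputable section

/-- The unit sphere `S^N` in `ℝ^{N+1}`. -/
abbrev Sph (N : ℕ) : Type := Metric.sphere (0 : EuclideanSpace ℝ (Fin (N + 1))) 1

/-- The surface measure `σ` on the unit sphere `S^N`. -/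
instance (N : ℕ) : MeasureSpace (Sph N) :=
  ⟨(volume : Measure (EuclideanSpace ℝ (Fin (N + 1)))).toSphere⟩

/-- Evaluation (restriction) of a polynomial in `N+1` variables at a point of the sphere. -/
def evalS {N : ℕ} (p : MvPolynomial (Fin (N + 1)) ℝ) (x : Sph N) : ℝ :=
  MvPolynomial.eval (fun i => (x : EuclideanSpace ℝ (Fin (N + 1))) i) p

/-- A polynomial in `N+1` variables is harmonic if it is annihilated by the Euclidean
Laplacian `∑ i, ∂²/∂x_i²`. -/
def IsHarmonicPoly {N : ℕ} (p : MvPolynomial (Fin (N + 1)) ℝ) : Prop :=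
  ∑ i : Fin (N + 1), MvPolynomial.pderiv i (MvPolynomial.pderiv i p) = 0

/-- The set of polynomials in `N+1` real variables which are harmonic and homogeneous of
degree `k`; restrictions to the sphere of its elements form the space `H_k` of spherical
harmonics of degree `k`. -/
def HarmHomog (N k : ℕ) : Set (MvPolynomial (Fin (N + 1)) ℝ) :=
  {p | p.IsHomogeneous k ∧ IsHarmonicPoly p}

/-- The eigenvalues `λ_k = k (k + N - 1)` of the Laplace–Beltrami operator on `S^N`. -/
def lamEV (N k : ℕ) : ℝ := (k : ℝ) * ((k : ℝ) + (N : ℝ) - 1)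

/-- `Z` is the family of reproducing kernels of the spaces `H_k` of spherical harmonics:
`Z k x ·` is (the restriction to the sphere of) a harmonic polynomial homogeneous of degree
`k`, and `∫ Z k x y * p y dσ(y) = p x` for every `p ∈ H_k` and every `x`. -/
def IsReproducingKernel (N : ℕ) (Z : ℕ → Sph N → Sph N → ℝ) : Prop :=
  (∀ (k : ℕ) (x : Sph N), ∃ p ∈ HarmHomog N k, ∀ y : Sph N, Z k x y = evalS p y) ∧
  (∀ (k : ℕ), ∀ p ∈ HarmHomog N k, ∀ x : Sph N,
    (∫ y : Sph N, Z k x y * evalS p y) = evalS p x)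

/-- The Fourier–Laplace component `Y_k(f, x) = ∫_{S^N} Z_k(x,y) f(y) dσ(y)`. -/
def Yk {N : ℕ} (Z : ℕ → Sph N → Sph N → ℝ) (k : ℕ) (f : Sph N → ℝ) (x : Sph N) : ℝ :=
  ∫ y : Sph N, Z k x y * f y

/-- The Riesz mean `E_n^α f(x) = ∑_{k=0}^{n} (1 - λ_k/λ_n)^α Y_k(f,x)`, where the `k = n`
term (with weight `0^α`) is taken to be `0`; hence the sum over `k < n`. -/
def RieszMean {N : ℕ} (Z : ℕ → Sph N → Sph N → ℝ) (α : ℝ) (n : ℕ) (f : Sph N → ℝ)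
    (x : Sph N) : ℝ :=
  ∑ k ∈ Finset.range n, (1 - lamEV N k / lamEV N n) ^ α * Yk Z k f x

/-- The maximal operator `E_*^α f(x) = sup_{n ≥ 1} |E_n^α f(x)|`, valued in `[0,∞]`. -/
def EStar {N : ℕ} (Z : ℕ → Sph N → Sph N → ℝ) (α : ℝ) (f : Sph N → ℝ) (x : Sph N) : ℝ≥0∞ :=
  ⨆ (n : ℕ) (_ : 1 ≤ n), ENNReal.ofReal |RieszMean Z α n f x|

/-- `M^α f(x) = sup_{n ≥ 1} ((1/n) ∑_{k=1}^n |E_k^α f(x)|²)^{1/2}`, valued in `[0,∞]`. -/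
def Mmax {N : ℕ} (Z : ℕ → Sph N → Sph N → ℝ) (α : ℝ) (f : Sph N → ℝ) (x : Sph N) : ℝ≥0∞ :=
  ⨆ (n : ℕ) (_ : 1 ≤ n),
    ENNReal.ofReal (((n : ℝ)⁻¹ * ∑ k ∈ Finset.Icc 1 n, (RieszMean Z α k f x) ^ 2) ^ (1/2 : ℝ))

/-- The square function `G^α f(x) = (∑_{n=1}^∞ (1/n) |E_n^{α+1} f(x) - E_n^α f(x)|²)^{1/2}`,
valued in `[0,∞]`. -/
def Gsq {N : ℕ} (Z : ℕ → Sph N → Sph N → ℝ) (α : ℝ) (f : Sph N → ℝ) (x : Sph N) : ℝ≥0∞ :=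
  (∑' n : ℕ, ENNReal.ofReal ((((n : ℝ) + 1))⁻¹ *
    (RieszMean Z (α + 1) (n + 1) f x - RieszMean Z α (n + 1) f x) ^ 2)) ^ (1/2 : ℝ)

/-- The Riesz weight bases decrease by at most `2 / n` at each step. -/
theorem lamEV_div_sub_le {N k n : ℕ} (hN : 2 ≤ N) (hk : k < n) :
    lamEV N (k + 1) / lamEV N n - lamEV N k / lamEV N n ≤ 2 / n := by
  have hN' : (2 : ℝ) ≤ N := by exact_mod_cast hN
  have hk' : (k : ℝ) + 1 ≤ n := by exact_mod_cast hk
  have hk0 : (0 : ℝ) ≤ k := k.cast_nonneg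
  have hn : (0 : ℝ) < n := by linarith
  have hs : (0 : ℝ) < n + N - 1 := by linarith
  rw [← sub_div, lamEV, lamEV, lamEV, div_le_div_iff₀ (mul_pos hn hs) hn]
  push_cast
  nlinarith [mul_le_mul_of_nonneg_left (show 2 * (k : ℝ) + N ≤ 2 * (n + N - 1) by linarith) hn.le]

theorem sub_div_le_one_sub_lamEV_div {N k n : ℕ} (hN : 2 ≤ N) (hk : k < n) :
    ((n : ℝ) - k) / n ≤ 1 - lamEV N k / lamEV N n := by
  have hN' : (2 : ℝ) ≤ N := by exact_mod_cast hN
  have hk' : (k : ℝ) + 1 ≤ n := by exact_mod_cast hk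
  have hk0 : (0 : ℝ) ≤ k := k.cast_nonneg
  have hn : (0 : ℝ) < n := by linarith
  have hs : (0 : ℝ) < n + N - 1 := by linarith
  have h : 1 - lamEV N k / lamEV N n - ((n : ℝ) - k) / n
      = k * (n - k) / (n * (n + N - 1)) := by
    rw [lamEV, lamEV]
    field_simp
    ring
  have : 0 ≤ (k : ℝ) * (n - k) / (n * (n + N - 1)) :=
    div_nonneg (mul_nonneg hk0 (by linarith)) (mul_pos hn hs).le
  linarith

theorem lamEV_mono {N : ℕ} (hN : 2 ≤ N) : Monotone (lamEV N) := by
  intro k m hkm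
  have hN' : (2 : ℝ) ≤ N := by exact_mod_cast hN
  have hkm' : (k : ℝ) ≤ m := by exact_mod_cast hkm
  have hk0 : (0 : ℝ) ≤ k := k.cast_nonneg
  exact mul_le_mul hkm' (by linarith) (by linarith) (by linarith)

theorem lamEV_nonneg {N : ℕ} (hN : 2 ≤ N) (k : ℕ) : 0 ≤ lamEV N k := by
  simpa [lamEV] using lamEV_mono hN k.zero_le

theorem rpow_eq_rpow_mul_one_add_rpow {x y : ℝ} (hx : 0 < x) (hy : 0 ≤ y) (β : ℝ) :
    y ^ β = x ^ β * (1 + (y / x - 1)) ^ β := by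
  rw [add_sub_cancel, ← Real.mul_rpow hx.le (div_nonneg hy hx.le), mul_div_cancel₀ _ hx.ne']

/-- A mean value bound for `rpow` in terms of the larger endpoint, for every positive exponent. -/
theorem rpow_sub_rpow_le_max_mul {x y β : ℝ} (hx : 0 < x) (hy : 0 ≤ y) (hyx : y ≤ x)
    (hβ : 0 < β) : x ^ β - y ^ β ≤ max 1 β * (x - y) * x ^ (β - 1) := by
  have hq1 : y / x ≤ 1 := (div_le_one hx).2 hyx
  have hq0 : 0 ≤ y / x := div_nonneg hy hx.le
  have hB : 1 - (1 + (y / x - 1)) ^ β ≤ max 1 β * (1 - y / x) := by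
    rcases le_total β 1 with h | h
    · rw [max_eq_left h, add_sub_cancel]
      have := Real.rpow_le_rpow_of_exponent_ge' hq0 hq1 hβ.le h
      rw [Real.rpow_one] at this
      linarith
    · rw [max_eq_right h]
      have := one_add_mul_self_le_rpow_one_add (s := y / x - 1) (by linarith) h
      linarith
  calc x ^ β - y ^ β = x ^ β * (1 - (1 + (y / x - 1)) ^ β) := by
        rw [rpow_eq_rpow_mul_one_add_rpow hx hy β]; ring
    _ ≤ x ^ β * (max 1 β * (1 - y / x)) := by gcongr
    _ = max 1 β * (x - y) * x ^ (β - 1) := by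
        rw [Real.rpow_sub_one hx.ne']
        field_simp

theorem sum_range_rpow_sub_one_le {s : ℝ} (hs : 0 < s) (hs1 : s ≤ 1) (n : ℕ) :
    ∑ j ∈ Finset.range n, ((j : ℝ) + 1) ^ (s - 1) ≤ (n : ℝ) ^ s / s := by
  induction n with
  | zero => simp [Real.zero_rpow hs.ne']
  | succ n ih =>
    rw [Finset.sum_range_succ]
    have hn : (0 : ℝ) ≤ n := n.cast_nonneg
    have hp : (0 : ℝ) < n + 1 := by linarith
    have hq : -1 ≤ (n : ℝ) / (n + 1) - 1 := by
      have := div_nonneg hn hp.le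
      linarith
    have key : (n : ℝ) ^ s ≤ (n + 1) ^ s - s * (n + 1) ^ (s - 1) :=
      calc (n : ℝ) ^ s = (n + 1) ^ s * (1 + ((n : ℝ) / (n + 1) - 1)) ^ s :=
            rpow_eq_rpow_mul_one_add_rpow hp hn s
        _ ≤ (n + 1) ^ s * (1 + s * ((n : ℝ) / (n + 1) - 1)) := by
            gcongr
            exact rpow_one_add_le_one_add_mul_self hq hs.le hs1
        _ = (n + 1) ^ s - s * (n + 1) ^ (s - 1) := by
            rw [Real.rpow_sub_one hp.ne']
            field_simp
            ring
    push_cast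
    rw [le_div_iff₀ hs] at ih ⊢
    linarith

/-- Riemann sums of `x ^ (2 * (β - 1))` on `[0, 1]` at right endpoints are bounded. -/
theorem sum_range_sub_div_rpow_le {β : ℝ} (hβ : 1 / 2 < β) {n : ℕ} (hn : 1 ≤ n) :
    ∑ k ∈ Finset.range n, (((n : ℝ) - k) / n) ^ (min 0 (2 * (β - 1)))
      ≤ n / min 1 (2 * β - 1) := by
  have hn0 : (0 : ℝ) < n := by exact_mod_cast hn
  set s := min 1 (2 * β - 1) with hs
  have hs0 : 0 < s := lt_min one_pos (by linarith)
  have he : min 0 (2 * (β - 1)) = s - 1 := by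
    rw [hs, ← min_sub_sub_right]; ring_nf
  rw [he, ← Finset.sum_range_reflect]
  calc ∑ j ∈ Finset.range n, (((n : ℝ) - (n - 1 - j : ℕ)) / n) ^ (s - 1)
      = (∑ j ∈ Finset.range n, ((j : ℝ) + 1) ^ (s - 1)) / (n : ℝ) ^ (s - 1) := by
        rw [Finset.sum_div]
        refine Finset.sum_congr rfl fun j hj => ?_
        have hj' := Finset.mem_range.1 hj
        have : ((n - 1 - j : ℕ) : ℝ) = n - 1 - j := by
          rw [Nat.sub_sub, Nat.cast_sub (by omega)]; push_cast; ring
        rw [this, ← Real.div_rpow (by positivity) hn0.le]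
        congr 2
        ring
    _ ≤ ((n : ℝ) ^ s / s) / (n : ℝ) ^ (s - 1) := by
        gcongr
        exact sum_range_rpow_sub_one_le hs0 (min_le_left _ _) n
    _ = n / s := by
        rw [Real.rpow_sub_one hn0.ne']
        have := (Real.rpow_pos_of_pos hn0 s).ne'
        field_simp

theorem sq_rpow_one_sub_lamEV_sub_le {N : ℕ} (hN : 2 ≤ N) {β : ℝ} (hβ : 0 < β) {k n : ℕ}
    (hk : k < n) :
    ((1 - lamEV N k / lamEV N n) ^ β - (1 - lamEV N (k + 1) / lamEV N n) ^ β) ^ 2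
      ≤ (max 1 β * (2 / n)) ^ 2 * (((n : ℝ) - k) / n) ^ (min 0 (2 * (β - 1))) := by
  have hk' : (k : ℝ) < n := by exact_mod_cast hk
  have hn : (0 : ℝ) < n := by exact_mod_cast (Nat.zero_le k).trans_lt hk
  have hd := lamEV_div_sub_le hN hk
  have hlow := sub_div_le_one_sub_lamEV_div hN hk
  have hmono : lamEV N k / lamEV N n ≤ lamEV N (k + 1) / lamEV N n :=
    div_le_div_of_nonneg_right (lamEV_mono hN k.le_succ) (lamEV_nonneg hN n)
  have hle1 : lamEV N (k + 1) / lamEV N n ≤ 1 :=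
    div_le_one_of_le₀ (lamEV_mono hN hk) (lamEV_nonneg hN n)
  have hk0 : 0 ≤ lamEV N k / lamEV N n := div_nonneg (lamEV_nonneg hN k) (lamEV_nonneg hN n)
  have ht : 0 < ((n : ℝ) - k) / n := div_pos (by linarith) hn
  set t := ((n : ℝ) - k) / n
  set x := 1 - lamEV N k / lamEV N n with hx
  set y := 1 - lamEV N (k + 1) / lamEV N n with hy
  have hx0 : 0 < x := ht.trans_le hlow
  have hy0 : 0 ≤ y := by linarith
  have hyx : y ≤ x := by linarith
  have hm : 0 < max 1 β := lt_max_of_lt_left one_pos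
  have hpow : (x ^ (β - 1)) ^ 2 ≤ t ^ (min 0 (2 * (β - 1))) := by
    rw [← Real.rpow_natCast, ← Real.rpow_mul hx0.le, Nat.cast_ofNat, mul_comm]
    exact (Real.rpow_le_rpow_of_exponent_ge hx0 (by linarith) (min_le_right _ _)).trans
      (Real.rpow_le_rpow_of_nonpos ht hlow (min_le_left _ _))
  calc (x ^ β - y ^ β) ^ 2 ≤ (max 1 β * (x - y) * x ^ (β - 1)) ^ 2 := by
        gcongr
        · exact sub_nonneg.2 (Real.rpow_le_rpow hy0 hyx hβ.le)
        · exact rpow_sub_rpow_le_max_mul hx0 hy0 hyx hβ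
    _ = (max 1 β * (x - y)) ^ 2 * (x ^ (β - 1)) ^ 2 := mul_pow _ _ _
    _ ≤ (max 1 β * (2 / n)) ^ 2 * t ^ (min 0 (2 * (β - 1))) := by
        have h0 : 0 ≤ x - y := sub_nonneg.2 hyx
        have h1 : x - y ≤ 2 / n := by linarith
        gcongr

/-- For `β > 1/2` there is a constant `C = C(β,N)` such that for all `n ≥ 1`,
`n · ∑_{k=0}^{n−1} ((1 − λ_k/λ_n)^β − (1 − λ_{k+1}/λ_n)^β)² ≤ C` (the `k+1 = n` summand is
`(1 − λ_k/λ_n)^{2β}` since `(1 − λ_n/λ_n)^β = 0`). -/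
theorem stmt4 (N : ℕ) (hN : 2 ≤ N) (β : ℝ) (hβ : (1/2 : ℝ) < β) :
    ∃ C : ℝ, ∀ n : ℕ, 1 ≤ n →
      (n : ℝ) * ∑ k ∈ Finset.range n,
        ((1 - lamEV N k / lamEV N n) ^ β - (1 - lamEV N (k + 1) / lamEV N n) ^ β) ^ 2
        ≤ C := by
  refine ⟨4 * max 1 β ^ 2 / min 1 (2 * β - 1), fun n hn => ?_⟩
  have hn0 : (0 : ℝ) < n := by exact_mod_cast hn
  calc (n : ℝ) * ∑ k ∈ Finset.range n,
        ((1 - lamEV N k / lamEV N n) ^ β - (1 - lamEV N (k + 1) / lamEV N n) ^ β) ^ 2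
      ≤ n * ∑ k ∈ Finset.range n,
          (max 1 β * (2 / n)) ^ 2 * (((n : ℝ) - k) / n) ^ (min 0 (2 * (β - 1))) := by
        gcongr with k hk
        exact sq_rpow_one_sub_lamEV_sub_le hN (by linarith) (Finset.mem_range.1 hk)
    _ ≤ n * ((max 1 β * (2 / n)) ^ 2 * (n / min 1 (2 * β - 1))) := by
        rw [← Finset.mul_sum]
        gcongr
        exact sum_range_sub_div_rpow_le hβ hn
    _ = 4 * max 1 β ^ 2 / min 1 (2 * β - 1) := by
        field_simp
        ring
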